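/- Consider the step-down test with critical values beta_i = i*alpha/(n+1-i*(1-alpha)), 1 <= i <= n. Suppose (i) the process t -> M_{I_0}(t) = sum_{i in I_0} (1(p_i <= t) - t)/(1-t), t in T = {0, beta_1, ..., beta_n}, is a super-martingale with respect to the filtration (F_t^T)_{t in T}; (ii) the p-values are PRDS on I_0; and (iii) each p_i, i in I_0, satisfies P(p_i <= x) <= x for all x in [0,1]. Then the step-down test controls the false discovery rate: FDR = E[V(tau_SD)/R(tau_SD)] <= alpha (with 0/0 := 0). -/

import Mathlib

open MeasureTheory Finset
open scoped Classical

noncomputable section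

variable {Ω : Type*}

/-- Number of p-values with index in `I` that are `≤ t` (e.g. false rejections `V`). -/
def Vc {n : ℕ} (p : Fin n → Ω → ℝ) (I : Finset (Fin n)) (t : ℝ) (ω : Ω) : ℕ :=
  (I.filter fun i => p i ω ≤ t).card

/-- Total number of rejections `R(t)`. -/
def Rc {n : ℕ} (p : Fin n → Ω → ℝ) (t : ℝ) (ω : Ω) : ℕ :=
  (Finset.univ.filter fun i => p i ω ≤ t).card

/-- Critical values `β_i = iα/(n+1-i(1-α))` (note `β_0 = 0`). -/
def beta (n : ℕ) (α : ℝ) (i : ℕ) : ℝ := i * α / (n + 1 - i * (1 - α))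

/-- Step-down boundary: `max {crit i : p_{j:n} ≤ crit j for all j ≤ i}`, max ∅ := 0.
(`p_{j:n} ≤ c ↔ R(c) ≥ j`.) -/
def tauSD {n : ℕ} (p : Fin n → Ω → ℝ) (crit : ℕ → ℝ) (ω : Ω) : ℝ :=
  if h : ((Finset.Icc 1 n).filter fun i =>
      ∀ j ∈ Finset.Icc 1 i, j ≤ Rc p (crit j) ω).Nonempty then
    (((Finset.Icc 1 n).filter fun i =>
      ∀ j ∈ Finset.Icc 1 i, j ≤ Rc p (crit j) ω)).sup' h crit
  else 0

/-- Step-up boundary: `max {crit i : p_{i:n} ≤ crit i}`, max ∅ := 0. -/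
def tauSU {n : ℕ} (p : Fin n → Ω → ℝ) (crit : ℕ → ℝ) (ω : Ω) : ℝ :=
  if h : ((Finset.Icc 1 n).filter fun i => i ≤ Rc p (crit i) ω).Nonempty then
    ((Finset.Icc 1 n).filter fun i => i ≤ Rc p (crit i) ω).sup' h crit
  else 0

/-- FDR estimator `\hat α_n(t)`. -/
def alphaHat {n : ℕ} (p : Fin n → Ω → ℝ) (t : ℝ) (ω : Ω) : ℝ :=
  (t / (1 - t)) * ((1 - (Rc p t ω : ℝ) / n) / ((Rc p t ω : ℝ) / n + 1 / n))

/-- `σ = min {crit i : p_{i:n} > crit i} ∧ crit n` (min ∅ := crit n). -/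
def sigmaB {n : ℕ} (p : Fin n → Ω → ℝ) (crit : ℕ → ℝ) (ω : Ω) : ℝ :=
  min (if h : ((Finset.Icc 1 n).filter fun i => Rc p (crit i) ω < i).Nonempty then
        ((Finset.Icc 1 n).filter fun i => Rc p (crit i) ω < i).inf' h crit
      else crit n) (crit n)

/-- The filtration `F_t^T`, `T = {0, β_1, ..., β_n}` indexed by `k ∈ {0,...,n}`. -/
def Ffilt {n : ℕ} (p : Fin n → Ω → ℝ) (B : ℕ → ℝ) (k : ℕ) : MeasurableSpace Ω :=
  MeasurableSpace.generateFrom {A | ∃ i : Fin n, ∃ j ≤ k, A = {ω | p i ω ≤ B j}}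

/-- The martingale-type process `M_J(t) = ∑_{i∈J} (1(p_i ≤ t) - t)/(1-t)` at `t`. -/
def Mval {n : ℕ} (p : Fin n → Ω → ℝ) (J : Finset (Fin n)) (t : ℝ) (ω : Ω) : ℝ :=
  ∑ i ∈ J, ((if p i ω ≤ t then (1 : ℝ) else 0) - t) / (1 - t)

/-- Positive regression dependence on the subset `I` (PRDS). -/
def PRDS {n : ℕ} [MeasurableSpace Ω] (μ : Measure Ω) (p : Fin n → Ω → ℝ)
    (I : Finset (Fin n)) : Prop :=
  ∀ i ∈ I, ∀ f : (Fin n → ℝ) → ℝ, Monotone f →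
    Integrable (fun ω => f fun j => p j ω) μ →
      ∃ g : ℝ → ℝ, Monotone g ∧
        (fun ω => g (p i ω))
          =ᵐ[μ] μ[(fun ω => f fun j => p j ω)|MeasurableSpace.comap (p i) inferInstance]

/-- The number of rejections of the step-down test: the largest `i ≤ n` such that
`R (crit j) ≥ j` for all `1 ≤ j ≤ i`. -/
def numSD {n : ℕ} (p : Fin n → Ω → ℝ) (crit : ℕ → ℝ) (ω : Ω) : ℕ :=
  Nat.findGreatest (fun i => ∀ j ∈ Finset.Icc 1 i, j ≤ Rc p (crit j) ω) n

lemma numSD_le {n : ℕ} (p : Fin n → Ω → ℝ) (crit : ℕ → ℝ) (ω : Ω) : numSD p crit ω ≤ n :=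
  @Nat.findGreatest_le _ (_) n

lemma numSD_spec {n : ℕ} (p : Fin n → Ω → ℝ) (crit : ℕ → ℝ) (ω : Ω) :
    ∀ j ∈ Finset.Icc 1 (numSD p crit ω), j ≤ Rc p (crit j) ω :=
  @Nat.findGreatest_spec 0 (fun i => ∀ j ∈ Finset.Icc 1 i, j ≤ Rc p (crit j) ω) (_) n
    (Nat.zero_le n) (by simp)

lemma le_numSD_iff {n : ℕ} (p : Fin n → Ω → ℝ) (crit : ℕ → ℝ) (ω : Ω) {i : ℕ} (hi : i ≤ n) :
    i ≤ numSD p crit ω ↔ ∀ j ∈ Finset.Icc 1 i, j ≤ Rc p (crit j) ω := by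
  constructor
  · intro h j hj
    rw [Finset.mem_Icc] at hj
    exact numSD_spec p crit ω j (Finset.mem_Icc.2 ⟨hj.1, hj.2.trans h⟩)
  · intro h
    exact @Nat.le_findGreatest i _ (_) n hi h

lemma Rc_le {n : ℕ} (p : Fin n → Ω → ℝ) (t : ℝ) (ω : Ω) : Rc p t ω ≤ n := by
  simpa [Rc] using Finset.card_filter_le (Finset.univ : Finset (Fin n)) (fun i => p i ω ≤ t)

lemma Rc_mono {n : ℕ} (p : Fin n → Ω → ℝ) (ω : Ω) {s t : ℝ} (h : s ≤ t) :
    Rc p s ω ≤ Rc p t ω :=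
  Finset.card_le_card fun i hi => by
    simp only [Finset.mem_filter, Finset.mem_univ, true_and] at hi ⊢
    exact hi.trans h

lemma beta_den_pos {n : ℕ} {α : ℝ} (hα : α ∈ Set.Ioo (0 : ℝ) 1) {k : ℕ} (hk : k ≤ n) :
    0 < (n : ℝ) + 1 - k * (1 - α) := by
  have h1 : (k : ℝ) ≤ n := by exact_mod_cast hk
  have h2 : (0 : ℝ) ≤ k := Nat.cast_nonneg k
  nlinarith [hα.1, hα.2]

lemma beta_zero (n : ℕ) (α : ℝ) : beta n α 0 = 0 := by simp [beta]

lemma beta_nonneg {n : ℕ} {α : ℝ} (hα : α ∈ Set.Ioo (0 : ℝ) 1) {k : ℕ} (hk : k ≤ n) :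
    0 ≤ beta n α k :=
  div_nonneg (mul_nonneg (Nat.cast_nonneg k) hα.1.le) (beta_den_pos hα hk).le

lemma beta_pos {n : ℕ} {α : ℝ} (hα : α ∈ Set.Ioo (0 : ℝ) 1) {k : ℕ} (hk : k ≤ n)
    (hk1 : 1 ≤ k) : 0 < beta n α k :=
  div_pos (mul_pos (by exact_mod_cast hk1) hα.1) (beta_den_pos hα hk)

lemma beta_lt_one {n : ℕ} {α : ℝ} (hα : α ∈ Set.Ioo (0 : ℝ) 1) {k : ℕ} (hk : k ≤ n) :
    beta n α k < 1 := by
  have h1 : (k : ℝ) ≤ n := by exact_mod_cast hk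
  rw [beta, div_lt_one (beta_den_pos hα hk)]
  linarith

lemma beta_mono {n : ℕ} {α : ℝ} (hα : α ∈ Set.Ioo (0 : ℝ) 1) {j k : ℕ} (hjk : j ≤ k)
    (hk : k ≤ n) : beta n α j ≤ beta n α k := by
  have h1 : (j : ℝ) ≤ k := by exact_mod_cast hjk
  have hj0 : (0 : ℝ) ≤ j := Nat.cast_nonneg j
  rw [beta, beta, div_le_div_iff₀ (beta_den_pos hα (hjk.trans hk)) (beta_den_pos hα hk)]
  have : 0 ≤ α * ((k : ℝ) - j) * (n + 1) :=
    mul_nonneg (mul_nonneg hα.1.le (by linarith)) (by positivity)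
  nlinarith

/-- The odds of the critical values. -/
lemma beta_div_one_sub {n : ℕ} {α : ℝ} (hα : α ∈ Set.Ioo (0 : ℝ) 1) {k : ℕ} (hk : k ≤ n) :
    beta n α k / (1 - beta n α k) * (n + 1 - k) = k * α := by
  have hd := beta_den_pos hα hk
  have h1 : (k : ℝ) ≤ n := by exact_mod_cast hk
  have h2 : (n : ℝ) + 1 - k ≠ 0 := by linarith
  have h3 : 1 - beta n α k = (n + 1 - k) / (n + 1 - k * (1 - α)) := by
    rw [beta, eq_div_iff hd.ne', sub_mul, div_mul_cancel₀ _ hd.ne']; ring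
  rw [h3, beta]
  field_simp

lemma tauSD_eq {n : ℕ} (p : Fin n → Ω → ℝ) {α : ℝ} (hα : α ∈ Set.Ioo (0 : ℝ) 1) (ω : Ω) :
    tauSD p (beta n α) ω = beta n α (numSD p (beta n α) ω) := by
  unfold tauSD
  split_ifs with h
  · apply le_antisymm
    · refine Finset.sup'_le _ _ fun i hi => ?_
      replace hi := (@Finset.mem_filter _ _ (_) _ _).1 hi
      rw [Finset.mem_Icc] at hi
      exact beta_mono hα ((le_numSD_iff p _ ω hi.1.2).2 hi.2) (numSD_le p _ ω)
    · refine Finset.le_sup' (f := beta n α) ?_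
      obtain ⟨i, hi⟩ := h
      replace hi := (@Finset.mem_filter _ _ (_) _ _).1 hi
      rw [Finset.mem_Icc] at hi
      refine (@Finset.mem_filter _ _ (_) _ _).2 ?_
      rw [Finset.mem_Icc]
      exact ⟨⟨hi.1.1.trans ((le_numSD_iff p _ ω hi.1.2).2 hi.2), numSD_le p _ ω⟩,
        numSD_spec p _ ω⟩
  · have : numSD p (beta n α) ω = 0 := by
      by_contra h0
      exact h ⟨numSD p (beta n α) ω, (@Finset.mem_filter _ _ (_) _ _).2 ⟨Finset.mem_Icc.2
        ⟨Nat.one_le_iff_ne_zero.2 h0, numSD_le p _ ω⟩, numSD_spec p _ ω⟩⟩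
    rw [this, beta_zero]

lemma Rc_beta_numSD_succ_le {n : ℕ} (p : Fin n → Ω → ℝ) (crit : ℕ → ℝ) (ω : Ω)
    (h : numSD p crit ω < n) :
    Rc p (crit (numSD p crit ω + 1)) ω ≤ numSD p crit ω := by
  by_contra hlt
  have : numSD p crit ω + 1 ≤ numSD p crit ω := by
    rw [le_numSD_iff p crit ω h]
    intro j hj
    rcases eq_or_lt_of_le (Finset.mem_Icc.1 hj).2 with hj' | hj'
    · rw [show j = numSD p crit ω + 1 from hj']
      omega
    · exact numSD_spec p crit ω j (Finset.mem_Icc.2 ⟨(Finset.mem_Icc.1 hj).1, by omega⟩)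
  omega

lemma numSD_le_Rc {n : ℕ} (p : Fin n → Ω → ℝ) (crit : ℕ → ℝ) (ω : Ω) :
    numSD p crit ω ≤ Rc p (crit (numSD p crit ω)) ω := by
  rcases Nat.eq_zero_or_pos (numSD p crit ω) with h | h
  · rw [h]; exact Nat.zero_le _
  · exact numSD_spec p crit ω _ (Finset.mem_Icc.2 ⟨h, le_rfl⟩)

lemma Rc_beta_numSD {n : ℕ} (p : Fin n → Ω → ℝ) {α : ℝ} (hα : α ∈ Set.Ioo (0 : ℝ) 1) (ω : Ω) :
    Rc p (beta n α (numSD p (beta n α) ω)) ω = numSD p (beta n α) ω := by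
  refine le_antisymm ?_ (numSD_le_Rc p _ ω)
  rcases eq_or_lt_of_le (numSD_le p (beta n α) ω) with h | h
  · rw [h]; exact Rc_le p _ ω
  · exact (Rc_mono p ω (beta_mono hα (Nat.le_succ _) h)).trans (Rc_beta_numSD_succ_le p _ ω h)

/-- No p-value lies between the step-down boundary and the next critical value. -/
lemma le_beta_succ_iff {n : ℕ} (p : Fin n → Ω → ℝ) {α : ℝ} (hα : α ∈ Set.Ioo (0 : ℝ) 1) (ω : Ω)
    (h : numSD p (beta n α) ω < n) (i : Fin n) :
    p i ω ≤ beta n α (numSD p (beta n α) ω + 1) ↔ p i ω ≤ beta n α (numSD p (beta n α) ω) := by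
  have hsub : (Finset.univ.filter fun i => p i ω ≤ beta n α (numSD p (beta n α) ω)) ⊆
      Finset.univ.filter fun i => p i ω ≤ beta n α (numSD p (beta n α) ω + 1) := by
    intro i hi
    simp only [Finset.mem_filter, Finset.mem_univ, true_and] at hi ⊢
    exact hi.trans (beta_mono hα (Nat.le_succ _) h)
  have heq := Finset.eq_of_subset_of_card_le hsub
    ((Rc_beta_numSD_succ_le p _ ω h).trans (numSD_le_Rc p _ ω))
  have := Finset.ext_iff.1 heq i
  simpa using this.symm

lemma Rc_le_Vc_add {n : ℕ} (p : Fin n → Ω → ℝ) (I : Finset (Fin n)) (t : ℝ) (ω : Ω) :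
    Rc p t ω + I.card ≤ Vc p I t ω + n := by
  have h : (Finset.univ.filter fun i => p i ω ≤ t) ⊆ (I.filter fun i => p i ω ≤ t) ∪ Iᶜ := by
    intro i hi
    by_cases hI : i ∈ I <;> simp_all
  have h1 := (Finset.card_le_card h).trans (Finset.card_union_le _ _)
  have h2 := Finset.card_add_card_compl I
  rw [Fintype.card_fin] at h2
  unfold Rc Vc
  omega

lemma Vc_cast {n : ℕ} (p : Fin n → Ω → ℝ) (I : Finset (Fin n)) (t : ℝ) (ω : Ω) :
    (Vc p I t ω : ℝ) = ∑ i ∈ I, if p i ω ≤ t then (1 : ℝ) else 0 := by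
  simp [Vc]

lemma Mval_eq {n : ℕ} (p : Fin n → Ω → ℝ) (I : Finset (Fin n)) (t : ℝ) (ω : Ω) :
    Mval p I t ω = (Vc p I t ω - I.card * t) / (1 - t) := by
  rw [Mval, ← Finset.sum_div, Finset.sum_sub_distrib, Vc_cast]
  simp

/-- Lower bound for the process at the stopped index `min (numSD + 1) n`. -/
lemma le_Mval_stopped {n : ℕ} (p : Fin n → Ω → ℝ) (I : Finset (Fin n)) {α : ℝ}
    (hα : α ∈ Set.Ioo (0 : ℝ) 1) (ω : Ω) :
    (1 - α) * (Vc p I (beta n α (numSD p (beta n α) ω)) ω : ℝ) - α * (n - I.card + 1)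
      ≤ Mval p I (beta n α (min (numSD p (beta n α) ω + 1) n)) ω := by
  have hR := Rc_le_Vc_add p I (beta n α (numSD p (beta n α) ω)) ω
  rw [Rc_beta_numSD p hα ω] at hR
  have hR' : (numSD p (beta n α) ω : ℝ) + I.card ≤
      Vc p I (beta n α (numSD p (beta n α) ω)) ω + n := by exact_mod_cast hR
  have hIn : (I.card : ℝ) ≤ n := by
    have := Finset.card_le_univ I
    rw [Fintype.card_fin] at this
    exact_mod_cast this
  have hVI : (Vc p I (beta n α (numSD p (beta n α) ω)) ω : ℝ) ≤ I.card := by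
    exact_mod_cast Finset.card_filter_le _ _
  have hV0 : (0 : ℝ) ≤ Vc p I (beta n α (numSD p (beta n α) ω)) ω := Nat.cast_nonneg _
  rw [Mval_eq]
  rcases eq_or_lt_of_le (numSD_le p (beta n α) ω) with h | h
  · have hmin : min (numSD p (beta n α) ω + 1) n = n := by omega
    rw [hmin]
    rw [h] at hR' hVI hV0 ⊢
    have hb := beta_lt_one hα (le_refl n)
    have hVeq : (Vc p I (beta n α n) ω : ℝ) = I.card := by linarith
    rw [hVeq]
    have : (I.card : ℝ) - I.card * beta n α n = I.card * (1 - beta n α n) := by ring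
    rw [this, mul_div_cancel_right₀ _ (by linarith)]
    nlinarith [hα.1, hα.2]
  · have hmin : min (numSD p (beta n α) ω + 1) n = numSD p (beta n α) ω + 1 := by omega
    have hVeq : Vc p I (beta n α (numSD p (beta n α) ω + 1)) ω =
        Vc p I (beta n α (numSD p (beta n α) ω)) ω := by
      unfold Vc
      simp only [le_beta_succ_iff p hα ω h]
    rw [hmin, hVeq]
    have hb := beta_lt_one hα (show numSD p (beta n α) ω + 1 ≤ n from h)
    have hb0 := beta_nonneg hα (show numSD p (beta n α) ω + 1 ≤ n from h)
    have hodds := beta_div_one_sub hα (show numSD p (beta n α) ω + 1 ≤ n from h)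
    generalize beta n α (numSD p (beta n α) ω + 1) = b at *
    generalize (Vc p I (beta n α (numSD p (beta n α) ω)) ω : ℝ) = V at *
    generalize numSD p (beta n α) ω = K at *
    push_cast at hodds
    have h1b : 0 < 1 - b := by linarith
    have e : (V - I.card * b) / (1 - b) = V - (I.card - V) * (b / (1 - b)) := by
      field_simp; ring
    have hle : (I.card - V) * (b / (1 - b)) ≤ b / (1 - b) * (n + 1 - (K + 1)) := by
      rw [mul_comm]
      exact mul_le_mul_of_nonneg_left (by linarith) (div_nonneg hb0 h1b.le)
    rw [e]
    nlinarith [hα.1, hα.2]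

lemma Ffilt_le {n : ℕ} [MeasurableSpace Ω] {p : Fin n → Ω → ℝ} (hpm : ∀ i, Measurable (p i))
    (B : ℕ → ℝ) (k : ℕ) : Ffilt p B k ≤ (inferInstance : MeasurableSpace Ω) := by
  refine MeasurableSpace.generateFrom_le ?_
  rintro _ ⟨i, j, -, rfl⟩
  exact measurableSet_le (hpm i) measurable_const

lemma measurable_Rc_Ffilt {n : ℕ} (p : Fin n → Ω → ℝ) (B : ℕ → ℝ) {j k : ℕ} (hjk : j ≤ k) :
    Measurable[Ffilt p B k] (Rc p (B j)) := by
  have : Rc p (B j) = fun ω => ∑ i : Fin n, if p i ω ≤ B j then 1 else 0 := by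
    funext ω; simp [Rc]
  rw [this]
  refine Finset.measurable_sum _ fun i _ => ?_
  refine Measurable.ite ?_ measurable_const measurable_const
  exact MeasurableSpace.measurableSet_generateFrom ⟨i, j, hjk, rfl⟩

lemma measurableSet_le_numSD {n : ℕ} (p : Fin n → Ω → ℝ) (B : ℕ → ℝ) {k : ℕ} (hk : k ≤ n) :
    MeasurableSet[Ffilt p B k] {ω | k ≤ numSD p B ω} := by
  have : {ω | k ≤ numSD p B ω} = ⋂ j ∈ Finset.Icc 1 k, {ω | j ≤ Rc p (B j) ω} := by
    ext ω
    simp only [Set.mem_ofPred_eq, Set.mem_iInter]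
    exact le_numSD_iff p B ω hk
  rw [this]
  refine Finset.measurableSet_biInter _ fun j hj => ?_
  exact measurable_Rc_Ffilt p B (Finset.mem_Icc.1 hj).2 measurableSet_Ici

lemma measurable_numSD {n : ℕ} [MeasurableSpace Ω] {p : Fin n → Ω → ℝ}
    (hpm : ∀ i, Measurable (p i)) (B : ℕ → ℝ) : Measurable (numSD p B) := by
  refine measurable_of_Ici fun k => ?_
  by_cases hk : k ≤ n
  · exact Ffilt_le hpm B k _ (measurableSet_le_numSD p B hk)
  · have : numSD p B ⁻¹' Set.Ici k = ∅ := by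
      ext ω
      have := numSD_le p B ω
      simp only [Set.mem_preimage, Set.mem_Ici, Set.mem_empty_iff_false, iff_false]
      omega
    rw [this]
    exact MeasurableSet.empty

lemma numSD_antitone {n : ℕ} (B : ℕ → ℝ) :
    Antitone (numSD (fun (i : Fin n) (x : Fin n → ℝ) => x i) B) := by
  intro x y hxy
  rw [le_numSD_iff _ _ _ (numSD_le _ _ _)]
  intro j hj
  refine (numSD_spec _ _ _ j hj).trans (Finset.card_le_card fun i hi => ?_)
  simp only [Finset.mem_filter, Finset.mem_univ, true_and] at hi ⊢
  exact (hxy i).trans hi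

/-- Optional stopping for the process `Mval` at the index `min (numSD + 1) n`. -/
lemma integral_Mval_stopped_le {n : ℕ} [MeasurableSpace Ω] (μ : Measure Ω)
    [IsProbabilityMeasure μ] (p : Fin n → Ω → ℝ) (I : Finset (Fin n)) (B : ℕ → ℝ)
    (hpm : ∀ i, Measurable (p i))
    (hsuper : ∀ j k : ℕ, j ≤ k → k ≤ n → ∀ A : Set Ω,
      MeasurableSet[Ffilt p B j] A →
        ∫ ω in A, Mval p I (B k) ω ∂μ ≤ ∫ ω in A, Mval p I (B j) ω ∂μ) :
    Integrable (fun ω => Mval p I (B (min (numSD p B ω + 1) n)) ω) μ ∧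
      ∫ ω, Mval p I (B (min (numSD p B ω + 1) n)) ω ∂μ ≤ ∫ ω, Mval p I (B 0) ω ∂μ := by
  have hint : ∀ t, Integrable (Mval p I t) μ := by
    intro t
    refine integrable_finsetSum _ fun i _ => Integrable.div_const (Integrable.sub ?_
      (integrable_const _)) _
    exact (integrable_const (1 : ℝ)).indicator (measurableSet_le (hpm i) measurable_const)
  have hA : ∀ k ∈ Finset.range n, MeasurableSet[Ffilt p B k] {ω | k ≤ numSD p B ω} :=
    fun k hk => measurableSet_le_numSD p B (Finset.mem_range.1 hk).le
  have hdecomp : (fun ω => Mval p I (B (min (numSD p B ω + 1) n)) ω) = fun ω => Mval p I (B 0) ω +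
      ∑ k ∈ Finset.range n, Set.indicator {ω | k ≤ numSD p B ω}
        (fun ω => Mval p I (B (k + 1)) ω - Mval p I (B k) ω) ω := by
    funext ω
    simp only [Set.indicator_apply, Set.mem_ofPred_eq]
    rw [← Finset.sum_filter]
    have : (Finset.range n).filter (fun k => k ≤ numSD p B ω) =
        Finset.range (min (numSD p B ω + 1) n) := by
      ext k
      simp only [Finset.mem_filter, Finset.mem_range]
      omega
    rw [this, Finset.sum_range_sub (fun k => Mval p I (B k) ω)]
    ring
  have hI : ∀ k ∈ Finset.range n, Integrable (Set.indicator {ω | k ≤ numSD p B ω}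
        (fun ω => Mval p I (B (k + 1)) ω - Mval p I (B k) ω)) μ := fun k hk =>
    ((hint _).sub (hint _)).indicator (Ffilt_le hpm B k _ (hA k hk))
  rw [hdecomp]
  refine ⟨(hint _).add (integrable_finsetSum _ hI), ?_⟩
  rw [integral_add (hint _) (integrable_finsetSum _ hI), integral_finsetSum _ hI]
  have : ∑ k ∈ Finset.range n, ∫ ω, Set.indicator {ω | k ≤ numSD p B ω}
        (fun ω => Mval p I (B (k + 1)) ω - Mval p I (B k) ω) ω ∂μ ≤ 0 := by
    refine Finset.sum_nonpos fun k hk => ?_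
    rw [integral_indicator (Ffilt_le hpm B k _ (hA k hk)),
      integral_sub (hint _).integrableOn (hint _).integrableOn]
    have := hsuper k (k + 1) (Nat.le_succ k) (Finset.mem_range.1 hk) _ (hA k hk)
    linarith
  linarith

/-- Under positive regression dependence, the conditional mean of a nondecreasing function
of the p-values given `p i ≤ x` is nondecreasing in `x` (in cross-multiplied form). -/
lemma PRDS.setIntegral_mul_le {n : ℕ} [MeasurableSpace Ω] {μ : Measure Ω}
    [IsProbabilityMeasure μ] {p : Fin n → Ω → ℝ} {I : Finset (Fin n)} (hprds : PRDS μ p I)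
    (hpm : ∀ i, Measurable (p i)) {i : Fin n} (hi : i ∈ I) {f : (Fin n → ℝ) → ℝ}
    (hf : Monotone f) (hfi : Integrable (fun ω => f fun j => p j ω) μ) {x y : ℝ} (hxy : x ≤ y) :
    (∫ ω in {ω | p i ω ≤ x}, f (fun j => p j ω) ∂μ) * μ.real {ω | p i ω ≤ y} ≤
      (∫ ω in {ω | p i ω ≤ y}, f (fun j => p j ω) ∂μ) * μ.real {ω | p i ω ≤ x} := by
  obtain ⟨g, hg, hgeq⟩ := hprds i hi f hf hfi
  have hm : MeasurableSpace.comap (p i) inferInstance ≤ (inferInstance : MeasurableSpace Ω) :=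
    (hpm i).comap_le
  have hgi : Integrable (fun ω => g (p i ω)) μ := integrable_condExp.congr hgeq.symm
  have hset : ∀ z, MeasurableSet[MeasurableSpace.comap (p i) inferInstance] {ω | p i ω ≤ z} :=
    fun z => ⟨Set.Iic z, measurableSet_Iic, rfl⟩
  have key : ∀ z, ∫ ω in {ω | p i ω ≤ z}, f (fun j => p j ω) ∂μ =
      ∫ ω in {ω | p i ω ≤ z}, g (p i ω) ∂μ := by
    intro z
    rw [← setIntegral_condExp hm hfi (hset z)]
    exact (integral_congr_ae (ae_restrict_of_ae hgeq)).symm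
  have hmx := hm _ (hset x)
  have hmy := hm _ (hset y)
  have hsub : {ω | p i ω ≤ x} ⊆ {ω | p i ω ≤ y} := fun ω h => le_trans h hxy
  have hmd := hmy.diff hmx
  have hsplit := setIntegral_sdiff hmx hgi.integrableOn hsub
  have hmeas := measureReal_sdiff (μ := μ) hsub hmx
  have ha : ∫ ω in {ω | p i ω ≤ x}, g (p i ω) ∂μ ≤ g x * μ.real {ω | p i ω ≤ x} := by
    have := setIntegral_mono_on hgi.integrableOn
      (integrable_const (g x)).integrableOn hmx fun ω hω => hg hω
    simpa [mul_comm] using this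
  have hb : g x * μ.real ({ω | p i ω ≤ y} \ {ω | p i ω ≤ x}) ≤
      ∫ ω in {ω | p i ω ≤ y} \ {ω | p i ω ≤ x}, g (p i ω) ∂μ := by
    have := setIntegral_mono_on (integrable_const (g x)).integrableOn hgi.integrableOn hmd
      fun ω hω => hg (not_le.1 hω.2).le
    simpa [mul_comm] using this
  rw [key, key]
  have hqx : 0 ≤ μ.real {ω | p i ω ≤ x} := measureReal_nonneg
  have hqd : 0 ≤ μ.real ({ω | p i ω ≤ y} \ {ω | p i ω ≤ x}) := measureReal_nonneg
  rw [hmeas] at hb hqd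
  rw [hsplit] at hb
  nlinarith [mul_le_mul_of_nonneg_right ha hqd, mul_le_mul_of_nonneg_left hb hqx]

lemma PRDS.measureReal_numSD_le {n : ℕ} [MeasurableSpace Ω] {μ : Measure Ω}
    [IsProbabilityMeasure μ] {p : Fin n → Ω → ℝ} {I : Finset (Fin n)} (hprds : PRDS μ p I)
    (hpm : ∀ i, Measurable (p i)) {i : Fin n} (hi : i ∈ I) (B : ℕ → ℝ) (k : ℕ)
    {x y : ℝ} (hxy : x ≤ y) :
    μ.real ({ω | numSD p B ω ≤ k} ∩ {ω | p i ω ≤ x}) * μ.real {ω | p i ω ≤ y} ≤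
      μ.real ({ω | numSD p B ω ≤ k} ∩ {ω | p i ω ≤ y}) * μ.real {ω | p i ω ≤ x} := by
  have hmK : MeasurableSet {ω | numSD p B ω ≤ k} := measurable_numSD hpm B measurableSet_Iic
  let f : (Fin n → ℝ) → ℝ := fun x =>
    if numSD (fun (i : Fin n) (x : Fin n → ℝ) => x i) B x ≤ k then 1 else 0
  have hf : Monotone f := by
    intro x y hxy
    have := numSD_antitone B hxy
    simp only [f]
    split_ifs
    · exact le_rfl
    · omega
    · exact zero_le_one
    · exact le_rfl
  have hfeq : (fun ω => f fun j => p j ω) = Set.indicator {ω | numSD p B ω ≤ k} fun _ => 1 := by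
    funext ω
    simp only [Set.indicator_apply, Set.mem_ofPred_eq]
    rfl
  have hfi : Integrable (fun ω => f fun j => p j ω) μ := by
    rw [hfeq]
    exact (integrable_const _).indicator hmK
  have h := hprds.setIntegral_mul_le hpm hi hf hfi hxy
  have he : ∀ z, ∫ ω in {ω | p i ω ≤ z}, f (fun j => p j ω) ∂μ =
      μ.real ({ω | numSD p B ω ≤ k} ∩ {ω | p i ω ≤ z}) := by
    intro z
    rw [hfeq, integral_indicator hmK]
    simp [Measure.restrict_restrict hmK]
  rwa [he, he] at h

/-- The key inequality for a single null p-value under positive regression dependence. -/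
lemma integral_indicator_div_beta_le {n : ℕ} [MeasurableSpace Ω] (μ : Measure Ω)
    [IsProbabilityMeasure μ] (p : Fin n → Ω → ℝ) (I : Finset (Fin n)) {α : ℝ}
    (hα : α ∈ Set.Ioo (0 : ℝ) 1) (hpm : ∀ i, Measurable (p i)) (hprds : PRDS μ p I)
    {i : Fin n} (hi : i ∈ I)
    (hstoch : ∀ x ∈ Set.Icc (0 : ℝ) 1, μ {ω | p i ω ≤ x} ≤ ENNReal.ofReal x) :
    Integrable (fun ω => (if p i ω ≤ beta n α (numSD p (beta n α) ω) then (1 : ℝ) else 0) /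
        beta n α (numSD p (beta n α) ω)) μ ∧
      ∫ ω, (if p i ω ≤ beta n α (numSD p (beta n α) ω) then (1 : ℝ) else 0) /
        beta n α (numSD p (beta n α) ω) ∂μ ≤ 1 := by
  set B := beta n α with hB
  set K := numSD p B with hK
  have hKm : Measurable K := measurable_numSD hpm B
  have hms : ∀ k, MeasurableSet ({ω | K ω = k} ∩ {ω | p i ω ≤ B k}) := fun k =>
    (hKm (measurableSet_singleton k)).inter (measurableSet_le (hpm i) measurable_const)
  have hdecomp : (fun ω => (if p i ω ≤ B (K ω) then (1 : ℝ) else 0) / B (K ω)) = fun ω =>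
      ∑ k ∈ Finset.range n, Set.indicator ({ω | K ω = k + 1} ∩ {ω | p i ω ≤ B (k + 1)})
        (fun _ => 1 / B (k + 1)) ω := by
    funext ω
    have hle : K ω ≤ n := numSD_le p B ω
    rcases hk0 : K ω with _ | k
    · simp [hB, beta_zero, hk0]
    · rw [Finset.sum_eq_single k]
      · simp only [Set.indicator_apply, Set.mem_inter_iff, Set.mem_ofPred_eq, hk0, true_and]
        split_ifs <;> simp
      · intro j _ hj
        refine Set.indicator_of_notMem (fun h => hj ?_) _
        have := h.1
        simp only [Set.mem_ofPred_eq, hk0] at this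
        omega
      · intro h
        simp only [Finset.mem_range] at h
        omega
  have hI : ∀ k ∈ Finset.range n, Integrable
      (Set.indicator ({ω | K ω = k + 1} ∩ {ω | p i ω ≤ B (k + 1)})
        (fun _ => 1 / B (k + 1))) μ := fun k _ => (integrable_const _).indicator (hms _)
  rw [hdecomp]
  refine ⟨integrable_finsetSum _ hI, ?_⟩
  rw [integral_finsetSum _ hI]
  let φ : ℕ → ℝ := fun k =>
    μ.real ({ω | K ω ≤ k} ∩ {ω | p i ω ≤ B k}) / μ.real {ω | p i ω ≤ B k}
  have hterm : ∀ k ∈ Finset.range n,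
      ∫ ω, Set.indicator ({ω | K ω = k + 1} ∩ {ω | p i ω ≤ B (k + 1)})
        (fun _ => 1 / B (k + 1)) ω ∂μ ≤ φ (k + 1) - φ k := by
    intro k hk
    have hkn : k + 1 ≤ n := Finset.mem_range.1 hk
    have hb : 0 < B (k + 1) := beta_pos hα hkn (Nat.le_add_left 1 k)
    have hb1 : B (k + 1) < 1 := beta_lt_one hα hkn
    have hbm : B k ≤ B (k + 1) := beta_mono hα (Nat.le_succ k) hkn
    have hq : μ.real {ω | p i ω ≤ B (k + 1)} ≤ B (k + 1) := by
      have := ENNReal.toReal_mono ENNReal.ofReal_ne_top (hstoch _ ⟨hb.le, hb1.le⟩)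
      rwa [ENNReal.toReal_ofReal hb.le] at this
    have hqm : μ.real {ω | p i ω ≤ B k} ≤ μ.real {ω | p i ω ≤ B (k + 1)} :=
      measureReal_mono fun ω h => le_trans h hbm
    have hmono := hprds.measureReal_numSD_le hpm hi B k hbm
    rw [integral_indicator (hms _)]
    simp only [integral_const, MeasurableSet.univ, measureReal_restrict_apply, Set.univ_inter,
      smul_eq_mul]
    have hdiff : μ.real ({ω | K ω ≤ k + 1} ∩ {ω | p i ω ≤ B (k + 1)}) =
        μ.real ({ω | K ω = k + 1} ∩ {ω | p i ω ≤ B (k + 1)}) +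
        μ.real ({ω | K ω ≤ k} ∩ {ω | p i ω ≤ B (k + 1)}) := by
      rw [← measureReal_union _
        (show MeasurableSet ({ω | K ω ≤ k} ∩ {ω | p i ω ≤ B (k + 1)}) from
          (hKm measurableSet_Iic).inter (measurableSet_le (hpm i) measurable_const))]
      · congr 1
        ext ω
        simp only [Set.mem_inter_iff, Set.mem_ofPred_eq, Set.mem_union]
        constructor
        · rintro ⟨h1, h2⟩
          rcases Nat.le_succ_iff.1 h1 with h | h
          · exact Or.inr ⟨h, h2⟩
          · exact Or.inl ⟨h, h2⟩
        · rintro (⟨h1, h2⟩ | ⟨h1, h2⟩)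
          · exact ⟨h1.le, h2⟩
          · exact ⟨by omega, h2⟩
      · rw [Set.disjoint_left]
        rintro ω ⟨h1, -⟩ ⟨h2, -⟩
        simp only [Set.mem_ofPred_eq] at h1 h2
        omega
    simp only [φ]
    rw [hdiff]
    have ha0 : 0 ≤ μ.real ({ω | K ω = k + 1} ∩ {ω | p i ω ≤ B (k + 1)}) := measureReal_nonneg
    have ha1 : μ.real ({ω | K ω = k + 1} ∩ {ω | p i ω ≤ B (k + 1)}) ≤
      μ.real {ω | p i ω ≤ B (k + 1)} := measureReal_mono Set.inter_subset_right
    have hc0 : 0 ≤ μ.real ({ω | K ω ≤ k} ∩ {ω | p i ω ≤ B (k + 1)}) := measureReal_nonneg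
    have hq0 : 0 ≤ μ.real {ω | p i ω ≤ B k} := measureReal_nonneg
    generalize μ.real ({ω | K ω = k + 1} ∩ {ω | p i ω ≤ B (k + 1)}) = a at *
    generalize μ.real ({ω | K ω ≤ k} ∩ {ω | p i ω ≤ B (k + 1)}) = c at *
    generalize μ.real ({ω | K ω ≤ k} ∩ {ω | p i ω ≤ B k}) = d at *
    generalize μ.real {ω | p i ω ≤ B k} = q at *
    generalize μ.real {ω | p i ω ≤ B (k + 1)} = r at *
    rcases eq_or_lt_of_le (hq0.trans hqm) with hr | hr
    · have hq' : q = 0 := by linarith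
      have ha' : a = 0 := by linarith
      rw [← hr, hq', ha']
      simp
    · have h1 : a * (1 / B (k + 1)) ≤ a / r := by
        rw [mul_one_div]
        exact div_le_div_of_nonneg_left ha0 hr hq
      have h2 : d / q ≤ c / r := by
        rcases eq_or_lt_of_le hq0 with hq' | hq'
        · rw [← hq', div_zero]
          exact div_nonneg hc0 hr.le
        · rwa [div_le_div_iff₀ hq' hr]
      rw [add_div]
      linarith
  refine (Finset.sum_le_sum hterm).trans ?_
  rw [Finset.sum_range_sub φ]
  have h1 : φ n ≤ 1 := div_le_one_of_le₀ (measureReal_mono Set.inter_subset_right)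
    measureReal_nonneg
  have h0 : 0 ≤ φ 0 := div_nonneg measureReal_nonneg measureReal_nonneg
  linarith

/-- FDR control of the `β_i`-based SD test under super-martingale
dependence (D1), PRDS (D2) on `I_0` and null p-values stochastically larger than
uniform. -/
theorem fdr_control_SD {n : ℕ} [MeasurableSpace Ω] (μ : Measure Ω)
    [IsProbabilityMeasure μ] (p : Fin n → Ω → ℝ) (I0 : Finset (Fin n)) (α : ℝ)
    (hn : 1 ≤ n) (hα : α ∈ Set.Ioo (0 : ℝ) 1) (hI0 : I0.Nonempty)
    (hp01 : ∀ i ω, p i ω ∈ Set.Icc (0 : ℝ) 1) (hpm : ∀ i, Measurable (p i))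
    (hsuper : ∀ j k : ℕ, j ≤ k → k ≤ n → ∀ A : Set Ω,
      MeasurableSet[Ffilt p (beta n α) j] A →
        ∫ ω in A, Mval p I0 (beta n α k) ω ∂μ ≤ ∫ ω in A, Mval p I0 (beta n α j) ω ∂μ)
    (hprds : PRDS μ p I0)
    (hstoch : ∀ i ∈ I0, ∀ x ∈ Set.Icc (0 : ℝ) 1, μ {ω | p i ω ≤ x} ≤ ENNReal.ofReal x) :
    ∫ ω, (Vc p I0 (tauSD p (beta n α) ω) ω : ℝ) / (Rc p (tauSD p (beta n α) ω) ω : ℝ) ∂μ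
      ≤ α := by
  set K := numSD p (beta n α) with hK
  have hKm : Measurable K := measurable_numSD hpm _
  let V : Ω → ℝ := fun ω => Vc p I0 (beta n α (K ω)) ω
  have hVi : Integrable V μ := by
    have : V = fun ω => ∑ i ∈ I0, if p i ω ≤ beta n α (K ω) then (1 : ℝ) else 0 :=
      funext fun ω => Vc_cast p I0 _ ω
    rw [this]
    refine integrable_finsetSum _ fun i _ => ?_
    exact (integrable_const (1 : ℝ)).indicator
      (measurableSet_le (hpm i) ((measurable_of_countable (beta n α)).comp hKm))
  have hX := fun i (hi : i ∈ I0) =>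
    integral_indicator_div_beta_le μ p I0 hα hpm hprds hi (hstoch i hi)
  obtain ⟨hMi, hM⟩ := integral_Mval_stopped_le μ p I0 (beta n α) hpm hsuper
  have hM0 : ∫ ω, Mval p I0 (beta n α 0) ω ∂μ = 0 := by
    refine integral_eq_zero_of_ae ?_
    have hnull : ∀ i ∈ I0, ∀ᵐ ω ∂μ, ¬ p i ω ≤ 0 := by
      intro i hi
      have := hstoch i hi 0 ⟨le_rfl, zero_le_one⟩
      rw [ENNReal.ofReal_zero, nonpos_iff_eq_zero] at this
      simpa [ae_iff] using this
    filter_upwards [(Finset.eventually_all I0).2 hnull] with ω hω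
    rw [beta_zero, Mval]
    exact Finset.sum_eq_zero fun i hi => by simp [hω i hi]
  have hVle : (1 - α) * ∫ ω, V ω ∂μ - α * (n - I0.card + 1) ≤ 0 := by
    have := integral_mono ((hVi.const_mul (1 - α)).sub
      (integrable_const (α * ((n : ℝ) - I0.card + 1)))) hMi fun ω => le_Mval_stopped p I0 hα ω
    rw [hM0] at hM
    refine le_trans (le_of_eq ?_) (this.trans hM)
    simp only [Pi.sub_apply]
    rw [integral_sub (hVi.const_mul _) (integrable_const _), integral_const_mul]
    simp
  have hpt : (fun ω => (Vc p I0 (tauSD p (beta n α) ω) ω : ℝ) /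
      (Rc p (tauSD p (beta n α) ω) ω : ℝ)) = fun ω => ((n : ℝ) + 1)⁻¹ * ((1 - α) * V ω +
        α * ∑ i ∈ I0, (if p i ω ≤ beta n α (K ω) then (1 : ℝ) else 0) / beta n α (K ω)) := by
    funext ω
    have hn0 : (n : ℝ) + 1 ≠ 0 := by positivity
    rw [tauSD_eq p hα, Rc_beta_numSD p hα, ← Finset.sum_div, ← Vc_cast, eq_inv_mul_iff_mul_eq₀ hn0]
    change _ * (V ω / (K ω : ℝ)) = _ + α * (V ω / _)
    rcases Nat.eq_zero_or_pos (K ω) with h | h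
    · have hV0 : V ω = 0 := by
        have h1 : Vc p I0 (beta n α (K ω)) ω ≤ Rc p (beta n α (K ω)) ω :=
          Finset.card_le_card (Finset.filter_subset_filter _ (Finset.subset_univ _))
        rw [hK, Rc_beta_numSD p hα, ← hK, h] at h1
        have h2 : Vc p I0 (beta n α (K ω)) ω = 0 := by rw [hK, ← hK, h]; omega
        simp only [V, h2, Nat.cast_zero]
      simp [hV0]
    · have hk : (K ω : ℝ) ≠ 0 := by exact_mod_cast h.ne'
      have hd := (beta_den_pos hα (numSD_le p (beta n α) ω)).ne'
      rw [← hK] at hd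
      have hα0 := hα.1.ne'
      rw [beta]
      field_simp
      ring
  have hSi : Integrable (fun ω => ∑ i ∈ I0,
      (if p i ω ≤ beta n α (K ω) then (1 : ℝ) else 0) / beta n α (K ω)) μ :=
    integrable_finsetSum _ fun i hi => (hX i hi).1
  have hS : ∫ ω, ∑ i ∈ I0, (if p i ω ≤ beta n α (K ω) then (1 : ℝ) else 0) /
      beta n α (K ω) ∂μ ≤ I0.card := by
    rw [integral_finsetSum _ fun i hi => (hX i hi).1]
    refine (Finset.sum_le_sum fun i hi => (hX i hi).2).trans ?_
    simp
  rw [hpt, integral_const_mul, integral_add (hVi.const_mul _) (hSi.const_mul _),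
    integral_const_mul, integral_const_mul, inv_mul_le_iff₀ (by positivity)]
  nlinarith [mul_le_mul_of_nonneg_left hS hα.1.le]

end
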